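/- Let K be a field of characteristic zero and 𝔤 a Lie algebra over K containing an sl₂-triple (h,e,f), i.e. elements with [h,e] = 2e, [h,f] = −2f, [e,f] = h. In the universal enveloping algebra U(𝔤) with canonical map ι : 𝔤 → U(𝔤), write z^{(k)} := z^k/k! for z ∈ U(𝔤) and binom(z; m) := (1/m!)·(z)(z−1)···(z−m+1) ∈ U(𝔤) for z ∈ U(𝔤), m ∈ ℕ. Then for all k, l ∈ ℕ: ι(e)^{(l)}·ι(f)^{(k)} = Σ_{m=0}^{min(k,l)} ι(f)^{(k−m)} · binom(ι(h) − (k+l−2m)·1; m) · ι(e)^{(l−m)}. -/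

import Mathlib

noncomputable section

open UniversalEnvelopingAlgebra

/-- The divided power `z^(k) = z^k / k!` in a `K`-algebra, `K` a field of characteristic 0. -/
def dpow (K : Type*) {U : Type*} [Field K] [Ring U] [Algebra K U] (z : U) (k : ℕ) : U :=
  (k.factorial : K)⁻¹ • z ^ k

/-- The binomial element `binom(z; m) = z(z-1)⋯(z-m+1)/m!` in a `K`-algebra. -/
def binomEl (K : Type*) {U : Type*} [Field K] [Ring U] [Algebra K U] (z : U) (m : ℕ) : U :=
  (m.factorial : K)⁻¹ • ((List.range m).map fun j : ℕ => z - (j : U)).prod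

section Straightening

variable {K U : Type*} [Field K] [Ring U] [Algebra K U]

/-- The falling factorial `z(z-1)⋯(z-m+1)`. -/
def fallingFactorial (z : U) (m : ℕ) : U :=
  ((List.range m).map fun j : ℕ => z - (j : U)).prod

lemma fallingFactorial_zero (z : U) : fallingFactorial z 0 = 1 := by
  simp [fallingFactorial]

lemma fallingFactorial_succ (z : U) (m : ℕ) :
    fallingFactorial z (m + 1) = fallingFactorial z m * (z - m) := by
  simp [fallingFactorial, List.range_succ]

lemma fallingFactorial_add_one_succ (z : U) (m : ℕ) :
    fallingFactorial (z + 1) (m + 1) = (z + 1) * fallingFactorial z m := by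
  simp [fallingFactorial, List.range_succ_eq_map, Function.comp_def]

lemma commute_fallingFactorial (z : U) (m : ℕ) : Commute z (fallingFactorial z m) := by
  induction m with
  | zero => rw [fallingFactorial_zero]; exact Commute.one_right z
  | succ m ih =>
    rw [fallingFactorial_succ]
    exact ih.mul_right ((Commute.refl z).sub_right (Nat.cast_commute m z).symm)

lemma binomEl_eq_smul_fallingFactorial (z : U) (m : ℕ) :
    binomEl K z m = (m.factorial : K)⁻¹ • fallingFactorial z m := rfl

lemma binomEl_zero (z : U) : binomEl K z 0 = 1 := by
  simp [binomEl]

lemma dpow_zero (z : U) : dpow K z 0 = 1 := by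
  simp [dpow]

lemma inv_factorial_eq_mul [CharZero K] (n : ℕ) :
    (n.factorial : K)⁻¹ = ((n + 1).factorial : K)⁻¹ * ((n + 1 : ℕ) : K) := by
  have : (n.factorial : K) ≠ 0 := Nat.cast_ne_zero.mpr n.factorial_ne_zero
  have : ((n : K) + 1) ≠ 0 := Nat.cast_add_one_ne_zero n
  rw [Nat.factorial_succ]
  push_cast
  field_simp

lemma inv_factorial_smul_eq [CharZero K] (n : ℕ) (u : U) :
    (n.factorial : K)⁻¹ • u = ((n + 1).factorial : K)⁻¹ • (((n : U) + 1) * u) := by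
  rw [inv_factorial_eq_mul, mul_smul, Nat.cast_smul_eq_nsmul, nsmul_eq_mul]
  push_cast
  rfl

lemma mul_dpow [CharZero K] (z : U) (n : ℕ) :
    z * dpow K z n = ((n : U) + 1) * dpow K z (n + 1) := by
  rw [dpow, dpow, mul_smul_comm, ← pow_succ', inv_factorial_smul_eq, mul_smul_comm]

/-- The scalar identity behind the induction step: with `x` in place of
`h - (k + l - 2n)`, it combines Pascal's rule and absorption. -/
lemma binomEl_recurrence [CharZero K] (x : U) (l n : ℕ) :
    ((l : U) - n) * binomEl K x (n + 1) + (x + l - n + 1) * binomEl K x n =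
      ((l : U) + 1) * binomEl K (x + 1) (n + 1) := by
  simp only [binomEl_eq_smul_fallingFactorial]
  rw [inv_factorial_smul_eq n, mul_smul_comm, mul_smul_comm, mul_smul_comm, ← smul_add,
    fallingFactorial_add_one_succ, fallingFactorial_succ]
  congr 1
  have hc : fallingFactorial x n * (x - n) = (x - n) * fallingFactorial x n :=
    ((commute_fallingFactorial x n).sub_left (Nat.cast_commute n _)).eq.symm
  rw [hc, ← mul_assoc, ← mul_assoc, ← mul_assoc, ← add_mul]
  congr 1
  have hn : x * (n : U) = n * x := (Nat.cast_commute n x).symm.eq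
  noncomm_ring
  simp only [hn]
  abel

variable {E F H : U}

lemma mul_fallingFactorial_of_lie (hHE : H * E - E * H = 2 * E) (c : ℤ) (m : ℕ) :
    E * fallingFactorial (H - c) m = fallingFactorial (H - c - 2) m * E := by
  have hE : E * H = H * E - 2 * E := by rw [← hHE]; abel
  induction m with
  | zero => simp [fallingFactorial_zero]
  | succ m ih =>
    rw [fallingFactorial_succ, fallingFactorial_succ, ← mul_assoc, ih, mul_assoc, mul_assoc]
    congr 1
    rw [mul_sub, mul_sub, hE, ← (Int.cast_commute c E).eq, ← (Nat.cast_commute m E).eq]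
    noncomm_ring

lemma mul_binomEl_of_lie (hHE : H * E - E * H = 2 * E) (c : ℤ) (m : ℕ) :
    E * binomEl K (H - c) m = binomEl K (H - c - 2) m * E := by
  simp only [binomEl_eq_smul_fallingFactorial, mul_smul_comm, smul_mul_assoc,
    mul_fallingFactorial_of_lie hHE]

lemma mul_pow_succ_of_lie (hHF : H * F - F * H = -(2 * F)) (hEF : E * F - F * E = H) (n : ℕ) :
    E * F ^ (n + 1) = F ^ (n + 1) * E + ((n : U) + 1) * (F ^ n * (H - n)) := by
  have hF : H * F = F * H - 2 * F := by rw [sub_eq_add_neg, ← hHF]; abel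
  have hE : E * F = F * E + H := by rw [← hEF]; abel
  induction n with
  | zero => simp [hE]
  | succ n ih =>
    have hHn : (H - n) * F = F * (H - 2 - n) := by
      rw [sub_mul, hF, (Nat.cast_commute n F).eq]
      noncomm_ring
    rw [pow_succ F (n + 1), ← mul_assoc, ih, add_mul, mul_assoc, hE, mul_assoc, mul_assoc, hHn,
      ← mul_assoc (F ^ n), ← pow_succ, mul_add, mul_assoc, add_assoc]
    congr 1
    rw [← mul_assoc, ← mul_assoc, ← Nat.cast_succ, ← Nat.cast_succ, (Nat.cast_commute _ _).eq,
      (Nat.cast_commute _ _).eq, mul_assoc, mul_assoc, ← mul_add]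
    congr 1
    push_cast
    noncomm_ring

lemma mul_dpow_succ_of_lie [CharZero K] (hHF : H * F - F * H = -(2 * F))
    (hEF : E * F - F * E = H) (n : ℕ) :
    E * dpow K F (n + 1) = dpow K F (n + 1) * E + dpow K F n * (H - n) := by
  simp only [dpow]
  rw [mul_smul_comm, mul_pow_succ_of_lie hHF hEF, smul_add, smul_mul_assoc, smul_mul_assoc,
    inv_factorial_smul_eq n]

/-- The divided power `z^(k-m)`, read as `0` when `m > k`. -/
def truncDpow (K : Type*) {U : Type*} [Field K] [Ring U] [Algebra K U] (z : U) (k m : ℕ) : U :=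
  if m ≤ k then dpow K z (k - m) else 0

lemma mul_truncDpow_of_lie [CharZero K] (hHF : H * F - F * H = -(2 * F))
    (hEF : E * F - F * E = H) (k m : ℕ) :
    E * truncDpow K F k m =
      truncDpow K F k m * E + truncDpow K F k (m + 1) * (H - (k - m - 1 : ℤ)) := by
  unfold truncDpow
  rcases lt_trichotomy m k with hm | rfl | hm
  · obtain ⟨n, rfl⟩ := Nat.exists_eq_add_of_lt hm
    rw [if_pos (by omega), if_pos (by omega), show m + n + 1 - m = n + 1 by omega,
      show m + n + 1 - (m + 1) = n by omega, mul_dpow_succ_of_lie hHF hEF,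
      show ((m + n + 1 : ℕ) : ℤ) - m - 1 = (n : ℤ) by push_cast; ring, Int.cast_natCast]
  · simp [dpow_zero]
  · rw [if_neg (by omega), if_neg (by omega)]
    simp

/-- The straightening identity in any algebra with elements satisfying the `sl₂` relations. -/
theorem dpow_mul_dpow_of_lie [CharZero K] (hHE : H * E - E * H = 2 * E)
    (hHF : H * F - F * H = -(2 * F)) (hEF : E * F - F * E = H) (k l : ℕ) :
    dpow K E l * dpow K F k = ∑ m ∈ Finset.range (l + 1),
      truncDpow K F k m * binomEl K (H - ((k + l - 2 * m : ℤ) : U)) m * dpow K E (l - m) := by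
  induction l with
  | zero => simp [dpow_zero, binomEl_zero, truncDpow]
  | succ l ih =>
    have hl : ((l + 1 : ℕ) : K) ≠ 0 := Nat.cast_ne_zero.mpr l.succ_ne_zero
    have hinj : ∀ u v : U, ((l : U) + 1) * u = ((l : U) + 1) * v → u = v := by
      intro u v huv
      rw [← Nat.cast_succ, ← nsmul_eq_mul, ← nsmul_eq_mul, ← Nat.cast_smul_eq_nsmul K,
        ← Nat.cast_smul_eq_nsmul K] at huv
      exact smul_right_injective U hl huv
    apply hinj
    rw [← mul_assoc, ← mul_dpow, mul_assoc, ih, Finset.mul_sum, Finset.mul_sum]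
    have hstep : ∀ m ∈ Finset.range (l + 1),
        E * (truncDpow K F k m * binomEl K (H - ((k + l - 2 * m : ℤ) : U)) m *
          dpow K E (l - m)) =
        truncDpow K F k m * (((l : U) + 1 - m) *
          binomEl K (H - ((k + l - 2 * m : ℤ) : U) - 2) m) * dpow K E (l + 1 - m) +
        truncDpow K F k (m + 1) * ((H - ((k - m - 1 : ℤ) : U)) *
          binomEl K (H - ((k + l - 2 * m : ℤ) : U)) m) * dpow K E (l + 1 - (m + 1)) := by
      intro m hm
      obtain ⟨n, rfl⟩ := Nat.exists_eq_add_of_le (Nat.lt_succ_iff.mp (Finset.mem_range.mp hm))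
      rw [← mul_assoc, ← mul_assoc, mul_truncDpow_of_lie hHF hEF, add_mul, add_mul,
        mul_assoc _ E, mul_binomEl_of_lie hHE, show m + n + 1 - (m + 1) = n by omega,
        show m + n + 1 - m = n + 1 by omega, show m + n - m = n by omega,
        mul_assoc _ (_ * E), mul_assoc _ E, mul_dpow,
        show (((m + n : ℕ) : U) + 1 - m) = ((n + 1 : ℕ) : U) by push_cast; abel,
        ← Nat.cast_succ, ← mul_assoc (binomEl K _ _), ← (Nat.cast_commute (n + 1) _).eq]
      simp only [mul_assoc]
    rw [Finset.sum_congr rfl hstep, Finset.sum_add_distrib]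
    have hlast : ∑ m ∈ Finset.range (l + 1), truncDpow K F k m * (((l : U) + 1 - m) *
          binomEl K (H - ((k + l - 2 * m : ℤ) : U) - 2) m) * dpow K E (l + 1 - m) =
        ∑ m ∈ Finset.range (l + 1 + 1), truncDpow K F k m * (((l : U) + 1 - m) *
          binomEl K (H - ((k + l - 2 * m : ℤ) : U) - 2) m) * dpow K E (l + 1 - m) := by
      rw [Finset.sum_range_succ _ (l + 1)]
      simp
    rw [hlast, Finset.sum_range_succ', Finset.sum_range_succ' _ (l + 1), add_right_comm,
      ← Finset.sum_add_distrib]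
    have hcomm : ∀ a b d : U, ((l : U) + 1) * (a * b * d) = a * (((l : U) + 1) * b) * d := by
      intro a b d
      rw [← Nat.cast_succ, ← mul_assoc, ← mul_assoc, (Nat.cast_commute (l + 1) a).eq, mul_assoc a]
    simp only [hcomm]
    congr 1
    · refine Finset.sum_congr rfl fun n _ => ?_
      have hx := binomEl_recurrence (K := K) (H - ((k + l - 2 * n : ℤ) : U)) l n
      have h₁ : (l : U) + 1 - ((n + 1 : ℕ) : U) = l - n := by push_cast; abel
      have h₂ : H - ((k + l - 2 * (n + 1 : ℕ) : ℤ) : U) - 2 = H - ((k + l - 2 * n : ℤ) : U) := by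
        push_cast; rw [← one_add_one_eq_two (R := U)]; noncomm_ring
      have h₃ : H - ((k - n - 1 : ℤ) : U) = H - ((k + l - 2 * n : ℤ) : U) + l - n + 1 := by
        push_cast; noncomm_ring
      have h₄ : H - ((k + (l + 1 : ℕ) - 2 * (n + 1 : ℕ) : ℤ) : U) =
          H - ((k + l - 2 * n : ℤ) : U) + 1 := by
        push_cast; noncomm_ring
      rw [h₁, h₂, h₃, h₄, ← add_mul, ← mul_add, hx]
    · simp [binomEl_zero]

lemma sum_range_truncDpow (z : U) (k l : ℕ) (g : ℕ → U) (g' : ℕ → U) :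
    ∑ m ∈ Finset.range (l + 1), truncDpow K z k m * g m * g' m =
      ∑ m ∈ Finset.range (min k l + 1), dpow K z (k - m) * g m * g' m := by
  rw [← Finset.sum_subset (Finset.range_subset_range.mpr (by omega : min k l + 1 ≤ l + 1))]
  · refine Finset.sum_congr rfl fun m hm => ?_
    rw [Finset.mem_range] at hm
    rw [truncDpow, if_pos (by omega)]
  · intro m hm hm'
    rw [Finset.mem_range] at hm hm'
    rw [truncDpow, if_neg (by omega), zero_mul, zero_mul]

lemma ι_lie {L : Type*} [LieRing L] [LieAlgebra K L] (x y : L) :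
    ι K ⁅x, y⁆ = ι K x * ι K y - ι K y * ι K x :=
  letI : LieRing (UniversalEnvelopingAlgebra K L) := LieRing.ofAssociativeRing
  LieHom.map_lie (ι K) x y

end Straightening

/-- Kostant's straightening identity
`e^(l) f^(k) = ∑_{m=0}^{min(k,l)} f^(k-m) binom(h - (k+l-2m); m) e^(l-m)`
in the universal enveloping algebra of a Lie algebra containing an sl₂-triple `(h,e,f)`. -/
theorem dpow_e_mul_dpow_f (K : Type*) [Field K] [CharZero K]
    (L : Type*) [LieRing L] [LieAlgebra K L] (h e f : L)
    (hhe : ⁅h, e⁆ = 2 • e) (hhf : ⁅h, f⁆ = -(2 • f)) (hef : ⁅e, f⁆ = h)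
    (k l : ℕ) :
    dpow K (ι K e : UniversalEnvelopingAlgebra K L) l *
        dpow K (ι K f : UniversalEnvelopingAlgebra K L) k =
      ∑ m ∈ Finset.range (min k l + 1),
        dpow K (ι K f : UniversalEnvelopingAlgebra K L) (k - m) *
          binomEl K
            (ι K h - (((k : ℤ) + (l : ℤ) - 2 * (m : ℤ)) • (1 : UniversalEnvelopingAlgebra K L)))
            m *
          dpow K (ι K e : UniversalEnvelopingAlgebra K L) (l - m) := by
  have hHE : ι K h * ι K e - ι K e * ι K h = 2 * ι K e := by
    rw [← ι_lie, hhe, map_nsmul, nsmul_eq_mul,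
      Nat.cast_ofNat]
  have hHF : ι K h * ι K f - ι K f * ι K h = -(2 * ι K f) := by
    rw [← ι_lie, hhf, map_neg, map_nsmul,
      nsmul_eq_mul, Nat.cast_ofNat]
  have hEF : ι K e * ι K f - ι K f * ι K e = ι K h := by
    rw [← ι_lie, hef]
  simp only [zsmul_one]
  rw [dpow_mul_dpow_of_lie hHE hHF hEF, sum_range_truncDpow]
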